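/- Let G and H be groupoids and φ : G ⥤ H a full and faithful functor. Then φ is essentially surjective if and only if there exist a groupoid K, a functor ψ : K ⥤ H that is full, faithful, and surjective on objects, a functor χ : K ⥤ G, and a natural transformation S : χ ⋙ φ ⟶ ψ. -/

import Mathlib

open CategoryTheory

universe v₁ u₁ v₂ u₂ v₃ u₃

/-- `φ : G ⥤ H` is locally split with respect to the groupoid `K`: there are a
functor `ψ : K ⥤ H` that is full, faithful and surjective on objects, a
functor `χ : K ⥤ G`, and a natural transformation `χ ⋙ φ ⟶ ψ`. -/
def SplitWitness.{w₃, x₃, w₁, x₁, w₂, x₂} {G : Type x₁} [Groupoid.{w₁} G]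
    {H : Type x₂} [Groupoid.{w₂} H] (φ : G ⥤ H) (K : Type x₃)
    [Groupoid.{w₃} K] : Prop :=
  ∃ (ψ : K ⥤ H) (χ : K ⥤ G),
    ψ.Full ∧ ψ.Faithful ∧ Function.Surjective ψ.obj ∧
      Nonempty (χ ⋙ φ ⟶ ψ)

/-- The comma category of two functors between groupoids is a groupoid. -/
instance commaIsGroupoid {A : Type*} [Category* A] [IsGroupoid A] {B : Type*} [Category* B]
    [IsGroupoid B] {T : Type*} [Category* T] (L : A ⥤ T) (R : B ⥤ T) :
    IsGroupoid (Comma L R) where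
  all_isIso f := (Comma.isoMk (asIso f.left) (asIso f.right) f.w).isIso_hom

/-- The second projection from the comma category of a full functor into a groupoid
along the identity is full. -/
theorem commaSnd_full {G : Type*} [Category* G] {H : Type*} [Groupoid H] (φ : G ⥤ H) [φ.Full] :
    (Comma.snd φ (𝟭 H)).Full where
  map_surjective {X Y} g :=
    ⟨{ left := φ.preimage (X.hom ≫ g ≫ inv Y.hom), right := g }, rfl⟩

/-- The second projection from the comma category of a faithful functor into a groupoid along the
identity is faithful. -/
theorem commaSnd_faithful {G : Type*} [Category* G] {H : Type*} [Groupoid H] (φ : G ⥤ H)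
    [φ.Faithful] : (Comma.snd φ (𝟭 H)).Faithful where
  map_injective {X Y} f g h := by
    have h' : f.right = g.right := h
    refine CommaMorphism.ext (φ.map_injective ?_) h'
    rw [← cancel_mono Y.hom, f.w, g.w, h']

/-- The second projection from the comma category of an essentially surjective functor along the
identity is surjective on objects. -/
theorem commaSnd_obj_surjective {G : Type*} [Category* G] {H : Type*} [Category* H] (φ : G ⥤ H)
    [φ.EssSurj] : Function.Surjective (Comma.snd φ (𝟭 H)).obj :=
  fun Y ↦ ⟨⟨φ.objPreimage Y, Y, (φ.objObjPreimageIso Y).hom⟩, rfl⟩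

/-- A full and faithful functor between groupoids is essentially surjective if
and only if it is locally split: there exist a groupoid `K`, a full and
faithful functor `ψ : K ⥤ H` surjective on objects, a functor `χ : K ⥤ G`,
and a natural transformation `χ ⋙ φ ⟶ ψ`.  (In the forward direction the
witness may be taken to be the comma category `Comma φ (𝟭 H)`, which lives in
the indicated universes.) -/
theorem essSurj_iff_locallySplit
    {G : Type u₁} [Groupoid.{v₁} G] {H : Type u₂} [Groupoid.{v₂} H]
    (φ : G ⥤ H) (h1 : φ.Full) (h2 : φ.Faithful) :
    φ.EssSurj ↔
      ∃ (K : Type (max u₁ u₂ v₂)) (iK : Groupoid.{max v₁ v₂} K),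
        @SplitWitness G _ H _ φ K iK := by
  constructor
  · intro _
    exact ⟨Comma φ (𝟭 H), Groupoid.ofIsGroupoid, Comma.snd φ (𝟭 H), Comma.fst φ (𝟭 H),
      commaSnd_full φ, commaSnd_faithful φ, commaSnd_obj_surjective φ,
      ⟨Comma.natTrans φ (𝟭 H)⟩⟩
  · rintro ⟨K, _, ψ, χ, -, -, hψ, ⟨S⟩⟩
    refine ⟨fun Y ↦ ?_⟩
    obtain ⟨k, rfl⟩ := hψ Y
    exact ⟨χ.obj k, ⟨asIso (S.app k)⟩⟩
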